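/- The rewriting system on terms over a single n-ary function symbol ⊗ with rules α_i : ⊗(x₁,…,x_i, ⊗(x_{i+1},…,x_{i+n}), x_{i+n+1},…,x_{2n-1}) → ⊗(x₁,…,x_{i-1}, ⊗(x_i,…,x_{i+n-1}), x_{i+n},…,x_{2n-1}) for 0 < i < n is terminating: there is no infinite sequence of rewrite steps. -/

import Mathlib

/-- Terms of the free algebra over variable set `V` with one n-ary operation ⊗. -/
inductive CTerm (n : ℕ) (V : Type*) : Type _
  | var (v : V) : CTerm n V
  | op (f : Fin n → CTerm n V) : CTerm n V

/-- `brk i x` is the term ⊗(x₀,…,x_{i-1}, ⊗(x_i,…,x_{i+n-1}), x_{i+n},…,x_{2n-2}):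
the n-ary tensor of the entries of `x` with one inner ⊗ placed at (0-based) position
`i`.  The Catalan rule α_i rewrites `brk i x` to `brk (i-1) x` for `0 < i < n`. -/
def brk {n : ℕ} {V : Type*} (i : ℕ) (x : ℕ → CTerm n V) : CTerm n V :=
  .op fun j => if (j : ℕ) < i then x (j : ℕ)
    else if (j : ℕ) = i then .op (fun k : Fin n => x (i + (k : ℕ)))
    else x ((j : ℕ) + n - 1)

/-- One rewrite step of the Catalan rewriting system: a rule
α_i : ⊗(x₁,…,x_i, ⊗(x_{i+1},…,x_{i+n}), x_{i+n+1},…,x_{2n-1}) →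
⊗(x₁,…,x_{i-1}, ⊗(x_i,…,x_{i+n-1}), x_{i+n},…,x_{2n-1}) (for 0 < i < n) applied at
some subterm position, with arbitrary terms substituted for the variables. -/
inductive CStep {n : ℕ} {V : Type*} : CTerm n V → CTerm n V → Prop
  | rule (i : ℕ) (h1 : 0 < i) (h2 : i < n) (x : ℕ → CTerm n V) :
      CStep (brk i x) (brk (i - 1) x)
  | congr {f g : Fin n → CTerm n V} (i : Fin n) :
      CStep (f i) (g i) → (∀ j, j ≠ i → f j = g j) → CStep (.op f) (.op g)

def CTerm.L {n : ℕ} {V : Type*} : CTerm n V → ℕ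
  | .var _ => 1
  | .op f => ∑ j, (f j).L

def CTerm.R {n : ℕ} {V : Type*} : CTerm n V → ℕ
  | .var _ => 0
  | .op f => ∑ j : Fin n, ((f j).R + (j : ℕ) * (f j).L)

theorem CTerm.L_pos {n : ℕ} (hn : 2 ≤ n) {V : Type*} (t : CTerm n V) : 0 < t.L := by
  induction t with
  | var v => simp [CTerm.L]
  | op f ih =>
    simp only [CTerm.L]
    exact Finset.sum_pos (fun j _ => ih j) ⟨⟨0, by omega⟩, Finset.mem_univ _⟩

theorem sum_brk_aux {n : ℕ} (i d : ℕ) (h : n = i + 1 + d) (F A C : ℕ → ℕ) (B : ℕ)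
    (hA : ∀ j, j < i → F j = A j) (hB : F i = B) (hC : ∀ j, i < j → F j = C j) :
    ∑ j : Fin n, F j = ∑ j ∈ Finset.range i, A j + B + ∑ k ∈ Finset.range d, C (i + 1 + k) := by
  rw [Fin.sum_univ_eq_sum_range F n, h, Finset.sum_range_add, Finset.sum_range_succ, hB]
  congr 1
  · congr 1
    exact Finset.sum_congr rfl (fun j hj => hA j (Finset.mem_range.1 hj))
  · exact Finset.sum_congr rfl (fun j _ => hC _ (by omega))

theorem L_brk {n : ℕ} {V : Type*} (i d : ℕ) (h : n = i + 1 + d) (x : ℕ → CTerm n V) :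
    (brk i x).L = ∑ j ∈ Finset.range i, (x j).L + ∑ k ∈ Finset.range n, (x (i + k)).L
      + ∑ k ∈ Finset.range d, (x (i + 1 + k + n - 1)).L := by
  rw [← Fin.sum_univ_eq_sum_range (fun k => (x (i + k)).L) n]
  simp only [brk, CTerm.L]
  refine sum_brk_aux i d h (fun j => (if j < i then x j
    else if j = i then .op (fun k : Fin n => x (i + (k : ℕ)))
    else x (j + n - 1)).L) (fun j => (x j).L) (fun j => (x (j + n - 1)).L) _ ?_ ?_ ?_
  · intro j hj; simp [hj]
  · simp [CTerm.L]
  · intro j hj; simp [show ¬ j < i by omega, show ¬ j = i by omega]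

theorem R_brk {n : ℕ} {V : Type*} (i d : ℕ) (h : n = i + 1 + d) (x : ℕ → CTerm n V) :
    (brk i x).R = ∑ j ∈ Finset.range i, ((x j).R + j * (x j).L)
      + ∑ k ∈ Finset.range n, ((x (i + k)).R + (i + k) * (x (i + k)).L)
      + ∑ k ∈ Finset.range d, ((x (i + 1 + k + n - 1)).R
          + (i + 1 + k) * (x (i + 1 + k + n - 1)).L) := by
  rw [← Fin.sum_univ_eq_sum_range (fun k => (x (i + k)).R + (i + k) * (x (i + k)).L) n]
  simp only [brk, CTerm.R]
  refine sum_brk_aux i d h (fun j => (if j < i then x j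
    else if j = i then .op (fun k : Fin n => x (i + (k : ℕ)))
    else x (j + n - 1)).R + j * (if j < i then x j
    else if j = i then .op (fun k : Fin n => x (i + (k : ℕ)))
    else x (j + n - 1)).L) (fun j => (x j).R + j * (x j).L)
    (fun j => (x (j + n - 1)).R + j * (x (j + n - 1)).L) _ ?_ ?_ ?_
  · intro j hj; simp [hj]
  · simp only [lt_irrefl, if_false, if_true, CTerm.R, CTerm.L, Finset.mul_sum]
    rw [← Finset.sum_add_distrib]
    exact Finset.sum_congr rfl (fun j _ => by ring)
  · intro j hj; simp [show ¬ j < i by omega, show ¬ j = i by omega]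

theorem brk_dec {n : ℕ} (hn : 2 ≤ n) {V : Type*} (i : ℕ) (h1 : 0 < i) (h2 : i < n)
    (x : ℕ → CTerm n V) :
    (brk (i - 1) x).L = (brk i x).L ∧ (brk (i - 1) x).R < (brk i x).R := by
  obtain ⟨p, rfl⟩ : ∃ p, i = p + 1 := ⟨i - 1, by omega⟩
  obtain ⟨d, hd⟩ : ∃ d, n = p + 1 + 1 + d := ⟨n - (p + 2), by omega⟩
  have shift : ∀ h : ℕ → ℕ, h p + ∑ k ∈ Finset.range n, h (p + 1 + k)
      = ∑ k ∈ Finset.range n, h (p + k) + h (p + n) := by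
    intro h
    rw [← Finset.sum_range_succ (fun k => h (p + k)), Finset.sum_range_succ', add_comm]
    simp only [add_zero]
    congr 1
    exact Finset.sum_congr rfl (fun k _ => by congr 1; ring)
  have e0 : p + 1 + 0 + n - 1 = p + n := by omega
  have ek : ∀ k, p + 1 + (k + 1) + n - 1 = p + 1 + 1 + k + n - 1 := fun k => by omega
  have ek' : ∀ k, p + 1 + (k + 1) = p + 1 + 1 + k := fun k => by omega
  rw [Nat.add_sub_cancel]
  constructor
  · rw [L_brk p (d + 1) (by omega), L_brk (p + 1) d hd, Finset.sum_range_succ',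
      Finset.sum_range_succ _ p]
    simp only [e0, ek]
    have := shift (fun m => (x m).L)
    omega
  · rw [R_brk p (d + 1) (by omega), R_brk (p + 1) d hd, Finset.sum_range_succ',
      Finset.sum_range_succ _ p]
    have e : ∑ k ∈ Finset.range d, ((x (p + 1 + (k + 1) + n - 1)).R
          + (p + 1 + (k + 1)) * (x (p + 1 + (k + 1) + n - 1)).L)
        = ∑ k ∈ Finset.range d, ((x (p + 1 + 1 + k + n - 1)).R
          + (p + 1 + 1 + k) * (x (p + 1 + 1 + k + n - 1)).L) :=
      Finset.sum_congr rfl (fun k _ => by rw [ek k, ek' k])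
    rw [e, e0, add_zero]
    have := shift (fun m => (x m).R + m * (x m).L)
    have h3 : (p + 1) * (x (p + n)).L < (p + n) * (x (p + n)).L :=
      Nat.mul_lt_mul_of_pos_right (by omega) (CTerm.L_pos hn _)
    omega

theorem CStep.dec {n : ℕ} (hn : 2 ≤ n) {V : Type*} {s t : CTerm n V} (h : CStep s t) :
    t.L = s.L ∧ t.R < s.R := by
  induction h with
  | rule i h1 h2 x => exact brk_dec hn i h1 h2 x
  | @congr f g i _ hj ih =>
    have hL : ∀ j, (g j).L = (f j).L := by
      intro j
      by_cases h : j = i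
      · subst h; exact ih.1
      · rw [hj j h]
    simp only [CTerm.L, CTerm.R, hL, true_and]
    refine Finset.sum_lt_sum (fun j _ => ?_) ⟨i, Finset.mem_univ _, by have := ih.2; omega⟩
    by_cases h : j = i
    · subst h; have := ih.2; omega
    · rw [hj j h]

/-- the Catalan rewriting system with rules α_i (0 < i < n) is
terminating: there is no infinite sequence of rewrite steps. -/
theorem stmt_9 {n : ℕ} (hn : 2 ≤ n) {V : Type*} :
    ¬ ∃ seq : ℕ → CTerm n V, ∀ k, CStep (seq k) (seq (k + 1)) := by
  rintro ⟨seq, hs⟩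
  have key : ∀ k, (seq k).R + k ≤ (seq 0).R := by
    intro k
    induction k with
    | zero => simp
    | succ k ih => have := (CStep.dec hn (hs k)).2; omega
  have := key ((seq 0).R + 1)
  omega
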